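/- The discrete problem T ȳ = 0 has a unique solution ȳ ∈ ℝ^{N+1}, and there exists a constant C > 0 depending only on m (independent of ε, N, and the mesh) such that for all v, w ∈ ℝ^{N+1}: ‖v − w‖_∞ ≤ C ‖Tv − Tw‖_∞. -/

import Mathlib

/-- `A(h) = (cosh(βh) − 1)/sinh(βh)`. -/
noncomputable def Acoef (β h : ℝ) : ℝ := (Real.cosh (β * h) - 1) / Real.sinh (β * h)

/-- `B(h) = (cosh(βh) + 1)/sinh(βh)`. -/
noncomputable def Bcoef (β h : ℝ) : ℝ := (Real.cosh (β * h) + 1) / Real.sinh (β * h)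

/-- The `i`-th component of the discrete operator `T` generated by the difference
scheme: `Tu_0 = -u_0`, `Tu_N = -u_N`, and for interior `i`,
`Tu_i = γ/(A(h_{i-1})+A(h_i)) · [ B(h_{i-1})u_{i-1} − (B(h_{i-1})+B(h_i))u_i + B(h_i)u_{i+1}`
`− (f(x_{i-1},u_{i-1})+f(x_i,u_i))A(h_{i-1})/γ − (f(x_i,u_i)+f(x_{i+1},u_{i+1}))A(h_i)/γ ]`. -/
noncomputable def Tdisc (f : ℝ → ℝ → ℝ) (γ β : ℝ) (x : ℕ → ℝ) (N : ℕ)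
    (u : ℕ → ℝ) (i : ℕ) : ℝ :=
  if i = 0 ∨ i = N then -u i
  else
    let h : ℕ → ℝ := fun k => x (k + 1) - x k
    γ / (Acoef β (h (i - 1)) + Acoef β (h i)) *
      (Bcoef β (h (i - 1)) * u (i - 1) -
        (Bcoef β (h (i - 1)) + Bcoef β (h i)) * u i + Bcoef β (h i) * u (i + 1) -
        (f (x (i - 1)) (u (i - 1)) + f (x i) (u i)) * Acoef β (h (i - 1)) / γ -
        (f (x i) (u i) + f (x (i + 1)) (u (i + 1))) * Acoef β (h i) / γ)

/-- The discrete operator `T` as a map `ℝ^{N+1} → ℝ^{N+1}`. -/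
noncomputable def TdiscF (f : ℝ → ℝ → ℝ) (γ β : ℝ) (x : ℕ → ℝ) (N : ℕ)
    (v : Fin (N + 1) → ℝ) : Fin (N + 1) → ℝ :=
  fun i => Tdisc f γ β x N (fun k => if hk : k < N + 1 then v ⟨k, hk⟩ else 0) i.1

open Filter Topology

lemma Acoef_pos {β h : ℝ} (hβ : 0 < β) (hh : 0 < h) : 0 < Acoef β h := by
  have hp : 0 < β * h := mul_pos hβ hh
  exact div_pos (sub_pos.2 (Real.one_lt_cosh.2 hp.ne')) (Real.sinh_pos_iff.2 hp)

lemma Acoef_le_Bcoef {β h : ℝ} (hβ : 0 < β) (hh : 0 < h) : Acoef β h ≤ Bcoef β h := by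
  have hs : 0 < Real.sinh (β * h) := Real.sinh_pos_iff.2 (mul_pos hβ hh)
  unfold Acoef Bcoef
  gcongr
  linarith

/-- The mean value theorem as a bounded difference quotient, including the degenerate case. -/
lemma exists_slope_of_deriv_bounds {g g' : ℝ → ℝ} {m γ : ℝ} (hg : ∀ u, HasDerivAt g (g' u) u)
    (hm : ∀ u, m ≤ g' u) (hγ : ∀ u, g' u ≤ γ) (a b : ℝ) :
    ∃ q, m ≤ q ∧ q ≤ γ ∧ g a - g b = q * (a - b) := by
  have hc : Continuous g := continuous_iff_continuousAt.2 fun u => (hg u).continuousAt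
  rcases lt_trichotomy a b with h | rfl | h
  · obtain ⟨t, -, ht⟩ := exists_hasDerivAt_eq_slope g g' h hc.continuousOn fun u _ => hg u
    refine ⟨g' t, hm t, hγ t, ?_⟩
    rw [eq_div_iff (sub_pos.2 h).ne'] at ht
    linarith
  · exact ⟨g' a, hm a, hγ a, by simp⟩
  · obtain ⟨t, -, ht⟩ := exists_hasDerivAt_eq_slope g g' h hc.continuousOn fun u _ => hg u
    refine ⟨g' t, hm t, hγ t, ?_⟩
    rw [eq_div_iff (sub_pos.2 h).ne'] at ht
    linarith

/-- A damped step of the linearized scheme at an interior mesh point is a contraction. -/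
lemma abs_damped_row_le {A₀ A₁ B₀ B₁ γ m q₀ q₁ q₂ z₀ z₁ z₂ M t : ℝ}
    (hA₀ : 0 < A₀) (hA₁ : 0 < A₁) (hB₀ : A₀ ≤ B₀) (hB₁ : A₁ ≤ B₁) (hγ : 0 < γ)
    (hq₀ : m ≤ q₀) (hq₀' : q₀ ≤ γ) (hq₁ : m ≤ q₁) (hq₁' : q₁ ≤ γ) (hq₂ : m ≤ q₂) (hq₂' : q₂ ≤ γ)
    (hz₀ : |z₀| ≤ M) (hz₁ : |z₁| ≤ M) (hz₂ : |z₂| ≤ M) (ht : 0 < t)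
    (htL : t * (γ / (A₀ + A₁) * (B₀ + B₁) + γ) ≤ 1) :
    |z₁ + t * (γ / (A₀ + A₁) * (B₀ * z₀ - (B₀ + B₁) * z₁ + B₁ * z₂
      - (q₀ * z₀ + q₁ * z₁) * A₀ / γ - (q₁ * z₁ + q₂ * z₂) * A₁ / γ))| ≤ (1 - t * (2 * m)) * M := by
  have hS : 0 < A₀ + A₁ := add_pos hA₀ hA₁
  set a₀ := A₀ / (A₀ + A₁) with ha₀
  set a₁ := A₁ / (A₀ + A₁) with ha₁
  set b₀ := γ / (A₀ + A₁) * B₀ with hb₀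
  set b₁ := γ / (A₀ + A₁) * B₁ with hb₁
  have ha : a₀ + a₁ = 1 := by rw [ha₀, ha₁]; field_simp
  have ha₀' : 0 ≤ a₀ := by positivity
  have ha₁' : 0 ≤ a₁ := by positivity
  have hab₀ : γ * a₀ ≤ b₀ := by
    rw [ha₀, hb₀, mul_div_assoc', div_mul_eq_mul_div]; gcongr
  have hab₁ : γ * a₁ ≤ b₁ := by
    rw [ha₁, hb₁, mul_div_assoc', div_mul_eq_mul_div]; gcongr
  have hM : 0 ≤ M := (abs_nonneg _).trans hz₁
  have key : z₁ + t * (γ / (A₀ + A₁) * (B₀ * z₀ - (B₀ + B₁) * z₁ + B₁ * z₂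
      - (q₀ * z₀ + q₁ * z₁) * A₀ / γ - (q₁ * z₁ + q₂ * z₂) * A₁ / γ))
      = t * (b₀ - q₀ * a₀) * z₀ + (1 - t * (b₀ + b₁ + q₁)) * z₁ + t * (b₁ - q₂ * a₁) * z₂ := by
    rw [ha₀, ha₁, hb₀, hb₁]; field_simp; ring
  have c₀ : 0 ≤ t * (b₀ - q₀ * a₀) :=
    mul_nonneg ht.le (by linarith [mul_le_mul_of_nonneg_right hq₀' ha₀'])
  have c₂ : 0 ≤ t * (b₁ - q₂ * a₁) :=
    mul_nonneg ht.le (by linarith [mul_le_mul_of_nonneg_right hq₂' ha₁'])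
  have c₁ : 0 ≤ 1 - t * (b₀ + b₁ + q₁) := by
    rw [mul_add (γ / (A₀ + A₁)), ← hb₀, ← hb₁] at htL
    linarith [mul_le_mul_of_nonneg_left hq₁' ht.le]
  have hq : 2 * m ≤ q₁ + q₀ * a₀ + q₂ * a₁ := by
    have : m = m * a₀ + m * a₁ := by rw [← mul_add, ha, mul_one]
    linarith [mul_le_mul_of_nonneg_right hq₀ ha₀', mul_le_mul_of_nonneg_right hq₂ ha₁']
  rw [key]
  calc _ ≤ t * (b₀ - q₀ * a₀) * |z₀| + (1 - t * (b₀ + b₁ + q₁)) * |z₁|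
        + t * (b₁ - q₂ * a₁) * |z₂| := by
        refine (abs_add_three _ _ _).trans_eq ?_
        rw [abs_mul, abs_mul _ z₁, abs_mul _ z₂, abs_of_nonneg c₀, abs_of_nonneg c₁,
          abs_of_nonneg c₂]
    _ ≤ t * (b₀ - q₀ * a₀) * M + (1 - t * (b₀ + b₁ + q₁)) * M + t * (b₁ - q₂ * a₁) * M := by
        gcongr
    _ = (1 - t * (q₁ + q₀ * a₀ + q₂ * a₁)) * M := by ring
    _ ≤ (1 - t * (2 * m)) * M := by gcongr

/-- If `v ↦ v + t • T v` is a contraction with factor `1 - t * c`, then `T` has a unique zero and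
is stable with constant `c⁻¹`. -/
lemma existsUnique_zero_and_stable_of_damped_contraction {E : Type*} [NormedAddCommGroup E]
    [NormedSpace ℝ E] [CompleteSpace E] {T : E → E} {t c : ℝ} (ht : 0 < t) (hc : 0 < c)
    (htc : t * c ≤ 1)
    (hT : ∀ v w, ‖(v - w) + t • (T v - T w)‖ ≤ (1 - t * c) * ‖v - w‖) :
    (∃! y, T y = 0) ∧ ∀ v w, ‖v - w‖ ≤ c⁻¹ * ‖T v - T w‖ := by
  have stable : ∀ v w, ‖v - w‖ ≤ c⁻¹ * ‖T v - T w‖ := by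
    intro v w
    have h : ‖v - w‖ - t * ‖T v - T w‖ ≤ ‖(v - w) + t • (T v - T w)‖ := by
      have := norm_sub_le ((v - w) + t • (T v - T w)) (t • (T v - T w))
      rw [add_sub_cancel_right, norm_smul, Real.norm_of_nonneg ht.le] at this
      linarith
    have h' : t * (c * ‖v - w‖) ≤ t * ‖T v - T w‖ := by linarith [hT v w]
    rw [inv_mul_eq_div, le_div_iff₀ hc, mul_comm]
    exact le_of_mul_le_mul_left h' ht
  refine ⟨?_, stable⟩
  have hK : ContractingWith (Real.toNNReal (1 - t * c)) (fun v => v + t • T v) := by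
    refine ⟨?_, LipschitzWith.of_dist_le_mul fun v w => ?_⟩
    · rw [Real.toNNReal_lt_one]
      linarith [mul_pos ht hc]
    · rw [Real.coe_toNNReal _ (sub_nonneg.2 htc), dist_eq_norm, dist_eq_norm,
        add_sub_add_comm, ← smul_sub]
      exact hT v w
  have hfix := hK.fixedPoint_isFixedPt
  refine ⟨hK.fixedPoint _, ?_, fun y hy => ?_⟩
  · have : t • T (hK.fixedPoint _) = 0 := by
      simpa [Function.IsFixedPt] using hfix
    exact (smul_eq_zero.1 this).resolve_left ht.ne'
  · exact hK.fixedPoint_unique (by simp [Function.IsFixedPt, hy])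

/-- Each component of the damped operator `v ↦ v + t • T v` is contractive for small `t > 0`. -/
lemma eventually_abs_damped_TdiscF_le {m γ β : ℝ} {N : ℕ} {f f' : ℝ → ℝ → ℝ} {x : ℕ → ℝ}
    (hγ : 0 < γ) (hβ : 0 < β)
    (hf : ∀ a u : ℝ, HasDerivAt (f a) (f' a u) u)
    (hlo : ∀ a ∈ Set.Icc (0 : ℝ) 1, ∀ u : ℝ, m ≤ f' a u)
    (hhi : ∀ a ∈ Set.Icc (0 : ℝ) 1, ∀ u : ℝ, f' a u ≤ γ)
    (hx : ∀ i ≤ N, x i ∈ Set.Icc (0 : ℝ) 1) (hmono : ∀ i < N, x i < x (i + 1))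
    (i : Fin (N + 1)) :
    ∀ᶠ t in 𝓝[>] (0 : ℝ), ∀ v w : Fin (N + 1) → ℝ,
      |(v i - w i) + t * (TdiscF f γ β x N v i - TdiscF f γ β x N w i)|
        ≤ (1 - t * min 1 (2 * m)) * ‖v - w‖ := by
  obtain ⟨i, hi⟩ := i
  have small : ∀ L : ℝ, ∀ᶠ t in 𝓝[>] (0 : ℝ), t * L ≤ 1 := fun L => by
    have h : Tendsto (fun t : ℝ => t * L) (𝓝 0) (𝓝 0) := by
      simpa using (continuous_mul_const L).tendsto (0 : ℝ)
    exact (h.mono_left nhdsWithin_le_nhds).eventually_le_const one_pos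
  by_cases hb : i = 0 ∨ i = N
  · filter_upwards [small 1, self_mem_nhdsWithin] with t ht1 (ht0 : 0 < t) v w
    have hz := norm_le_pi_norm (v - w) ⟨i, hi⟩
    rw [Pi.sub_apply, Real.norm_eq_abs] at hz
    have hT : ∀ u, TdiscF f γ β x N u ⟨i, hi⟩ = - u ⟨i, hi⟩ := fun u => by
      simp only [TdiscF, Tdisc, if_pos hb, dif_pos hi]
    rw [hT, hT]
    calc _ = |(1 - t) * (v ⟨i, hi⟩ - w ⟨i, hi⟩)| := by ring_nf
      _ = (1 - t) * |v ⟨i, hi⟩ - w ⟨i, hi⟩| := by rw [abs_mul, abs_of_nonneg (by linarith)]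
      _ ≤ (1 - t * min 1 (2 * m)) * ‖v - w‖ := by
        have : t * min 1 (2 * m) ≤ t := mul_le_of_le_one_right ht0.le (min_le_left _ _)
        gcongr
        linarith
  · obtain ⟨k, rfl⟩ : ∃ k, i = k + 1 := Nat.exists_eq_succ_of_ne_zero fun h => hb (.inl h)
    have hk2 : k + 1 + 1 < N + 1 := by omega
    have hk0 : k < N + 1 := by omega
    have hh₀ : 0 < x (k + 1) - x k := sub_pos.2 (hmono k (by omega))
    have hh₁ : 0 < x (k + 1 + 1) - x (k + 1) := sub_pos.2 (hmono (k + 1) (by omega))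
    filter_upwards [small _, self_mem_nhdsWithin] with t htL (ht0 : 0 < t) v w
    have hz : ∀ j, |v j - w j| ≤ ‖v - w‖ := norm_le_pi_norm (v - w)
    have slope : ∀ j (hj : j < N + 1), ∃ q, m ≤ q ∧ q ≤ γ ∧
        f (x j) (v ⟨j, hj⟩) - f (x j) (w ⟨j, hj⟩) = q * (v ⟨j, hj⟩ - w ⟨j, hj⟩) := fun j hj =>
      exists_slope_of_deriv_bounds (hf (x j)) (hlo _ (hx j (by omega)))
        (hhi _ (hx j (by omega))) _ _
    obtain ⟨q₀, l₀, u₀, e₀⟩ := slope k hk0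
    obtain ⟨q₁, l₁, u₁, e₁⟩ := slope (k + 1) hi
    obtain ⟨q₂, l₂, u₂, e₂⟩ := slope (k + 1 + 1) hk2
    have row := abs_damped_row_le (Acoef_pos hβ hh₀) (Acoef_pos hβ hh₁) (Acoef_le_Bcoef hβ hh₀)
      (Acoef_le_Bcoef hβ hh₁) hγ l₀ u₀ l₁ u₁ l₂ u₂ (hz ⟨k, hk0⟩) (hz ⟨k + 1, hi⟩)
      (hz ⟨k + 1 + 1, hk2⟩) ht0 htL
    rw [← e₀, ← e₁, ← e₂] at row
    calc _ ≤ (1 - t * (2 * m)) * ‖v - w‖ := by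
          refine Eq.trans_le (congrArg abs ?_) row
          simp only [TdiscF, Tdisc, if_neg hb, dif_pos hi, dif_pos hk0, dif_pos hk2,
            Nat.add_sub_cancel]
          ring
      _ ≤ _ := by
          gcongr
          exact min_le_right _ _

/-- The discrete problem `Tȳ = 0` has a unique solution, and `T` is stable:
`‖v − w‖_∞ ≤ C ‖Tv − Tw‖_∞` with `C` depending only on `m`. -/
theorem discrete_problem_stability (m : ℝ) (hm : 0 < m) :
    ∃ C > (0:ℝ),
      ∀ (ε γ β : ℝ) (N : ℕ) (f f' : ℝ → ℝ → ℝ) (x : ℕ → ℝ),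
        0 < ε → ε < 1 →
        β = Real.sqrt γ / ε →
        (∀ a u : ℝ, HasDerivAt (f a) (f' a u) u) →
        (∀ a ∈ Set.Icc (0:ℝ) 1, ∀ u : ℝ, m ≤ f' a u) →
        (∀ a ∈ Set.Icc (0:ℝ) 1, ∀ u : ℝ, f' a u ≤ γ) →
        2 ≤ N → x 0 = 0 → x N = 1 →
        (∀ i : ℕ, i < N → x i < x (i + 1)) →
        (∃! yb : Fin (N + 1) → ℝ, TdiscF f γ β x N yb = 0) ∧
        (∀ v w : Fin (N + 1) → ℝ,
          ‖v - w‖ ≤ C * ‖TdiscF f γ β x N v - TdiscF f γ β x N w‖) := by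
  refine ⟨(min 1 (2 * m))⁻¹, by positivity, ?_⟩
  intro ε γ β N f f' x hε _ hβ hf hlo hhi _ hx0 hxN hmono
  have hγ : 0 < γ := hm.trans_le ((hlo 0 (by simp) 0).trans (hhi 0 (by simp) 0))
  have hβ' : 0 < β := hβ ▸ div_pos (Real.sqrt_pos.2 hγ) hε
  have hle : MonotoneOn x (Set.Iic N) :=
    monotoneOn_of_le_succ Set.ordConnected_Iic fun i _ _ hi => (hmono i hi).le
  have hx : ∀ i ≤ N, x i ∈ Set.Icc (0 : ℝ) 1 := fun i hi =>
    ⟨hx0 ▸ hle (Nat.zero_le N) hi (Nat.zero_le i), hxN ▸ hle hi (le_refl N) hi⟩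
  have hrows := eventually_all.2 fun i =>
    eventually_abs_damped_TdiscF_le hγ hβ' hf hlo hhi hx hmono i
  have hsmall : ∀ᶠ t in 𝓝[>] (0 : ℝ), t < 1 :=
    nhdsWithin_le_nhds (eventually_lt_nhds one_pos)
  obtain ⟨t, ht, ht1, ht0⟩ := (hrows.and (hsmall.and self_mem_nhdsWithin)).exists
  have hc : 0 < min 1 (2 * m) := by positivity
  have ht0 : 0 < t := ht0
  have htc : t * min 1 (2 * m) ≤ 1 := mul_le_one₀ ht1.le hc.le (min_le_left _ _)
  refine existsUnique_zero_and_stable_of_damped_contraction ht0 hc htc fun v w => ?_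
  exact (pi_norm_le_iff_of_nonneg
    (mul_nonneg (sub_nonneg.2 htc) (norm_nonneg _))).2 fun i => ht i v w
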